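/- arXiv:1206.5903 — 4 statements merged into one kernel-verified Lean document; each statement's English description precedes it below -/
import Mathlib

section
/- Let F be a homogeneous polynomial of degree 4 in X0, X1, X2, X3 over ℂ which vanishes on each of the six coordinate lines of P^3, i.e. F(x) = 0 for every x ∈ ℂ^4 satisfying x_i = x_j = 0, for each pair 0 ≤ i < j ≤ 3. Then there exist complex numbers a0, a1, a2, b0, b1, b3, c0, c2, c3, d1, d2, d3 and δ such that F = (a0X0 + a1X1 + a2X2)·X0X1X2 + (b0X0 + b1X1 + b3X3)·X0X1X3 + (c0X0 + c2X2 + c3X3)·X0X2X3 + (d1X1 + d2X2 + d3X3)·X1X2X3 + δ·X0X1X2X3. -/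
open MvPolynomial

lemma tq_coeff_bind (i j : Fin 4) (p : MvPolynomial (Fin 4) ℂ) (m : Fin 4 →₀ ℕ)
    (hi : m i = 0) (hj : m j = 0) :
    coeff m (bind₁ (fun k => if k = i ∨ k = j then (0 : MvPolynomial (Fin 4) ℂ) else X k) p)
      = coeff m p := by
  classical
  rw [p.as_sum, map_sum, coeff_sum, coeff_sum]
  refine Finset.sum_congr rfl fun n _ => ?_
  rw [bind₁_monomial]
  by_cases h : n i = 0 ∧ n j = 0
  · congr 1
    rw [monomial_eq]
    congr 1
    refine Finset.prod_congr rfl fun k hk => ?_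
    have hk' : n k ≠ 0 := by simpa using hk
    rw [if_neg]
    rintro (rfl | rfl)
    · exact hk' h.1
    · exact hk' h.2
  · have h1 : coeff m (monomial n (coeff n p)) = 0 := by
      rw [coeff_monomial, if_neg]
      rintro rfl
      exact h ⟨hi, hj⟩
    rw [h1]
    have : ∃ k, n k ≠ 0 ∧ (k = i ∨ k = j) := by
      by_cases hn : n i = 0
      · exact ⟨j, fun hh => h ⟨hn, hh⟩, Or.inr rfl⟩
      · exact ⟨i, hn, Or.inl rfl⟩
    obtain ⟨k, hk, hk2⟩ := this
    rw [Finset.prod_eq_zero (i := k) (by simpa using hk) (by rw [if_pos hk2, zero_pow hk])]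
    simp

lemma tq_coeff_zero (F : MvPolynomial (Fin 4) ℂ) (i j : Fin 4)
    (h : ∀ x : Fin 4 → ℂ, x i = 0 → x j = 0 → eval x F = 0)
    (m : Fin 4 →₀ ℕ) (hi : m i = 0) (hj : m j = 0) : coeff m F = 0 := by
  rw [← tq_coeff_bind i j F m hi hj]
  have : bind₁ (fun k => if k = i ∨ k = j then (0 : MvPolynomial (Fin 4) ℂ) else X k) F = 0 := by
    refine MvPolynomial.funext fun x => ?_
    rw [map_zero, ← coe_aeval_eq_eval, RingHom.coe_coe, aeval_bind₁, ← RingHom.coe_coe, coe_aeval_eq_eval]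
    apply h <;> simp
  rw [this, coeff_zero]

/-- The exponent vector with the given entries. -/
noncomputable def tqExp (a b c d : ℕ) : Fin 4 →₀ ℕ := Finsupp.equivFunOnFinite.symm ![a, b, c, d]

lemma tq_monomial (a b c d : ℕ) (z : ℂ) :
    monomial (tqExp a b c d) z = C z * (X 0 ^ a * X 1 ^ b * X 2 ^ c * X 3 ^ d) := by
  rw [monomial_eq, Finsupp.prod_fintype _ _ (by simp), Fin.prod_univ_four]
  simp [tqExp]

/-- The thirteen admissible exponents of a quartic. -/
def tqList : List (ℕ × ℕ × ℕ × ℕ) :=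
  [(2, 1, 1, 0), (1, 2, 1, 0), (1, 1, 2, 0), (2, 1, 0, 1), (1, 2, 0, 1), (1, 1, 0, 2), (2, 0, 1, 1), (1, 0, 2, 1), (1, 0, 1, 2), (0, 2, 1, 1), (0, 1, 2, 1), (0, 1, 1, 2), (1, 1, 1, 1)]

lemma tq_mem (a b c d : ℕ) (h : a + b + c + d = 4) (h01 : ¬ (a = 0 ∧ b = 0))
    (h02 : ¬ (a = 0 ∧ c = 0)) (h03 : ¬ (a = 0 ∧ d = 0)) (h12 : ¬ (b = 0 ∧ c = 0))
    (h13 : ¬ (b = 0 ∧ d = 0)) (h23 : ¬ (c = 0 ∧ d = 0)) : (a, b, c, d) ∈ tqList := by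
  have ha : a ≤ 2 := by omega
  have hb : b ≤ 2 := by omega
  have hc : c ≤ 2 := by omega
  have hd : d = 4 - a - b - c := by omega
  subst hd
  interval_cases a <;> interval_cases b <;> interval_cases c <;> first | omega | decide

lemma tq_exp_inj : Function.Injective
    (fun t : ℕ × ℕ × ℕ × ℕ => tqExp t.1 t.2.1 t.2.2.1 t.2.2.2) := by
  rintro ⟨a, b, c, d⟩ ⟨a', b', c', d'⟩ h
  have h0 := DFunLike.congr_fun h 0
  have h1 := DFunLike.congr_fun h 1
  have h2 := DFunLike.congr_fun h 2
  have h3 := DFunLike.congr_fun h 3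
  simp [tqExp] at h0 h1 h2 h3
  simp [h0, h1, h2, h3]

/-- **Corollary 0.2.** A tetrahedral quartic in `ℙ³`, i.e. a quartic whose homogeneous
equation `F` vanishes on all six coordinate lines (the edges of the coordinate
tetrahedron), has equation
`F = (a0X0+a1X1+a2X2)·X0X1X2 + (b0X0+b1X1+b3X3)·X0X1X3 + (c0X0+c2X2+c3X3)·X0X2X3 +
     (d1X1+d2X2+d3X3)·X1X2X3 + δ·X0X1X2X3`. -/
theorem tetrahedral_quartic_equation
    (F : MvPolynomial (Fin 4) ℂ) (hF : F.IsHomogeneous 4)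
    (hvanish : ∀ i j : Fin 4, i < j →
      ∀ x : Fin 4 → ℂ, x i = 0 → x j = 0 → eval x F = 0) :
    ∃ a0 a1 a2 b0 b1 b3 c0 c2 c3 d1 d2 d3 δ : ℂ,
      F = (C a0 * X 0 + C a1 * X 1 + C a2 * X 2) * (X 0 * X 1 * X 2) +
          (C b0 * X 0 + C b1 * X 1 + C b3 * X 3) * (X 0 * X 1 * X 3) +
          (C c0 * X 0 + C c2 * X 2 + C c3 * X 3) * (X 0 * X 2 * X 3) +
          (C d1 * X 1 + C d2 * X 2 + C d3 * X 3) * (X 1 * X 2 * X 3) +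
          C δ * (X 0 * X 1 * X 2 * X 3) := by
  classical
  have key : F = ∑ t ∈ tqList.toFinset, monomial (tqExp t.1 t.2.1 t.2.2.1 t.2.2.2)
      (coeff (tqExp t.1 t.2.1 t.2.2.1 t.2.2.2) F) := by
    rw [← Finset.sum_image (f := fun m => monomial m (coeff m F))
      (g := fun t : ℕ × ℕ × ℕ × ℕ => tqExp t.1 t.2.1 t.2.2.1 t.2.2.2)
      (fun _ _ _ _ h => tq_exp_inj h)]
    conv_lhs => rw [F.as_sum]
    refine Finset.sum_subset (fun m hm => ?_) (fun m _ hm => ?_)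
    · have hm' : coeff m F ≠ 0 := by simpa using hm
      have hdeg : m 0 + m 1 + m 2 + m 3 = 4 := by
        have h := hF hm'
        rw [Finsupp.weight_apply, Finsupp.sum_fintype _ _ (by simp), Fin.sum_univ_four] at h
        simpa using h
      have hz : ∀ i j : Fin 4, i < j → ¬ (m i = 0 ∧ m j = 0) := fun i j hij h =>
        hm' (tq_coeff_zero F i j (hvanish i j hij) m h.1 h.2)
      refine Finset.mem_image.2 ⟨(m 0, m 1, m 2, m 3), ?_, ?_⟩
      · rw [List.mem_toFinset]
        exact tq_mem _ _ _ _ hdeg (hz 0 1 (by decide)) (hz 0 2 (by decide)) (hz 0 3 (by decide))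
          (hz 1 2 (by decide)) (hz 1 3 (by decide)) (hz 2 3 (by decide))
      · ext k
        fin_cases k <;> simp [tqExp]
    · rw [notMem_support_iff.1 hm, monomial_zero]
  rw [List.sum_toFinset _ (by decide)] at key
  simp only [tqList, List.map_cons, List.map_nil, List.sum_cons, List.sum_nil, tq_monomial] at key
  refine ⟨coeff (tqExp 2 1 1 0) F,
    coeff (tqExp 1 2 1 0) F,
    coeff (tqExp 1 1 2 0) F,
    coeff (tqExp 2 1 0 1) F,
    coeff (tqExp 1 2 0 1) F,
    coeff (tqExp 1 1 0 2) F,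
    coeff (tqExp 2 0 1 1) F,
    coeff (tqExp 1 0 2 1) F,
    coeff (tqExp 1 0 1 2) F,
    coeff (tqExp 0 2 1 1) F,
    coeff (tqExp 0 1 2 1) F,
    coeff (tqExp 0 1 1 2) F,
    coeff (tqExp 1 1 1 1) F, ?_⟩
  refine key.trans ?_
  ring
end

section
/- The matrix M is an even lattice Gram matrix of rank 11, signature (1,10) and discriminant 2^7. Precisely: (a) for every vector v ∈ ℤ^11, the integer vᵀ·M·v is even; (b) det M = 128; (c) the real symmetric matrix M has exactly one positive eigenvalue and ten negative eigenvalues (counted with multiplicity); in particular M is invertible. -/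
open Matrix

/-- The incidence matrix of the curves `L12, L13, L14, L23, L24, L34, E1, E2, E3, E4, R1`
on the minimal resolution of singularities of a 4-nodal tetrahedral quartic, with rows and
columns indexed in the order `(l12, l13, l14, l23, l24, l34, e1, e2, e3, e4, r1)`. -/
def M : Matrix (Fin 11) (Fin 11) ℤ := Matrix.of
  ![![-2, 0, 0, 0, 0, 0, 1, 1, 0, 0, 0],
    ![ 0,-2, 0, 0, 0, 0, 1, 0, 1, 0, 0],
    ![ 0, 0,-2, 0, 0, 0, 1, 0, 0, 1, 0],
    ![ 0, 0, 0,-2, 0, 0, 0, 1, 1, 0, 1],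
    ![ 0, 0, 0, 0,-2, 0, 0, 1, 0, 1, 1],
    ![ 0, 0, 0, 0, 0,-2, 0, 0, 1, 1, 1],
    ![ 1, 1, 1, 0, 0, 0,-2, 0, 0, 0, 0],
    ![ 1, 0, 0, 1, 1, 0, 0,-2, 0, 0, 0],
    ![ 0, 1, 0, 1, 0, 1, 0, 0,-2, 0, 0],
    ![ 0, 0, 1, 0, 1, 1, 0, 0, 0,-2, 0],
    ![ 0, 0, 0, 1, 1, 1, 0, 0, 0, 0,-2]]



/-- A unitriangular row operation making all leading minors of `M` nonzero. -/
def auxA : Matrix (Fin 11) (Fin 11) ℤ := Matrix.of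
  ![![1, 0, 0, 0, 0, 0, 0, 0, 1, 0, 0],
    ![0, 1, 0, 0, 0, 0, 0, 0, 0, 0, 0],
    ![0, 0, 1, 0, 0, 0, 0, 0, 0, 0, 0],
    ![0, 0, 0, 1, 0, 0, 0, 0, 0, 0, 0],
    ![0, 0, 0, 0, 1, 0, 0, 0, 0, 0, 0],
    ![0, 0, 0, 0, 0, 1, 0, 0, 0, 0, 0],
    ![0, 0, 0, 0, 0, 0, 1, 0, 0, 0, 0],
    ![0, 0, 0, 0, 0, 0, 0, 1, 0, 0, 0],
    ![0, 0, 0, 0, 0, 0, 0, 0, 1, 0, 0],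
    ![0, 0, 0, 0, 0, 0, 0, 0, 0, 1, 0],
    ![0, 0, 0, 0, 0, 0, 0, 0, 0, 0, 1]]

/-- Column operations bringing `auxA * M` to lower triangular form. -/
def auxN : Matrix (Fin 11) (Fin 11) ℤ := Matrix.of
  ![![1, 1, 0, 1, 0, 1, 3, 6, -4, -1, -2],
    ![0, 2, 0, 0, 0, 0, 2, 3, 1, -1, -2],
    ![0, 0, 1, 0, 0, 0, 2, 3, -1, 0, -2],
    ![0, 0, 0, 2, 0, 0, 0, 1, 1, -1, 0],
    ![0, 0, 0, 0, 1, 0, 0, 1, -1, 0, 0],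
    ![0, 0, 0, 0, 0, 2, 0, 0, 2, 0, 0],
    ![0, 0, 0, 0, 0, 0, 4, 6, -2, -1, -3],
    ![0, 0, 0, 0, 0, 0, 0, 2, -2, -1, -1],
    ![0, 0, 0, 0, 0, 0, 0, 0, 4, -1, -1],
    ![0, 0, 0, 0, 0, 0, 0, 0, 0, 1, -1],
    ![0, 0, 0, 0, 0, 0, 0, 0, 0, 0, 2]]

/-- The resulting lower triangular matrix. -/
def auxL : Matrix (Fin 11) (Fin 11) ℤ := Matrix.of
  ![![-2, 0, 0, 0, 0, 0, 0, 0, 0, 0, 0],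
    ![0, -4, 0, 0, 0, 0, 0, 0, 0, 0, 0],
    ![0, 0, -2, 0, 0, 0, 0, 0, 0, 0, 0],
    ![0, 0, 0, -4, 0, 0, 0, 0, 0, 0, 0],
    ![0, 0, 0, 0, -2, 0, 0, 0, 0, 0, 0],
    ![0, 0, 0, 0, 0, -4, 0, 0, 0, 0, 0],
    ![1, 3, 1, 1, 0, 1, -1, 0, 0, 0, 0],
    ![1, 1, 0, 3, 1, 1, 3, 4, 0, 0, 0],
    ![0, 2, 0, 2, 0, 2, 2, 4, -4, 0, 0],
    ![0, 0, 1, 0, 1, 2, 2, 4, 0, -2, 0],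
    ![0, 0, 0, 2, 1, 2, 0, 2, 2, -1, -4]]

theorem aux_mul : auxA * M * auxN = auxL := by decide +kernel

theorem auxA_det : auxA.det = 1 := by
  have h : ∀ i j : Fin 11, j < i → (fun a b => auxA a b : Fin 11 → Fin 11 → ℤ) i j = 0 := by decide +kernel
  rw [Matrix.det_of_upperTriangular (fun i j hij => h i j hij)]
  decide +kernel

theorem auxN_det : auxN.det = 512 := by
  have h : ∀ i j : Fin 11, j < i → (fun a b => auxN a b : Fin 11 → Fin 11 → ℤ) i j = 0 := by decide +kernel
  rw [Matrix.det_of_upperTriangular (fun i j hij => h i j hij)]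
  decide +kernel

theorem auxL_det : auxL.det = 65536 := by
  have h : ∀ i j : Fin 11, i < j → (fun a b => auxL a b : Fin 11 → Fin 11 → ℤ) i j = 0 := by decide +kernel
  rw [Matrix.det_of_lowerTriangular _ (fun i j hij => h i j hij)]
  decide +kernel

theorem M_det_eq : M.det = 128 := by
  have h := congrArg Matrix.det aux_mul
  rw [Matrix.det_mul, Matrix.det_mul, auxA_det, auxN_det, auxL_det] at h
  omega

theorem M_even (v : Fin 11 → ℤ) : Even (v ⬝ᵥ M.mulVec v) := by
  refine ⟨-(v 0^2+v 1^2+v 2^2+v 3^2+v 4^2+v 5^2+v 6^2+v 7^2+v 8^2+v 9^2+v 10^2)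
    + v 6 * (v 0 + v 1 + v 2) + v 7 * (v 0 + v 3 + v 4) + v 8 * (v 1 + v 3 + v 5)
    + v 9 * (v 2 + v 4 + v 5) + v 10 * (v 3 + v 4 + v 5), ?_⟩
  simp [M, Matrix.mulVec, dotProduct, Fin.sum_univ_succ]
  ring_nf!

/-- On the hyperplane `e2 + e3 + e4 = 0` the form is nonpositive. -/
theorem M_form_le (v : Fin 11 → ℝ) (hv : v 7 + v 8 + v 9 = 0) :
    v ⬝ᵥ (M.map (Int.cast : ℤ → ℝ)).mulVec v ≤ 0 := by
  have e : v ⬝ᵥ (M.map (Int.cast : ℤ → ℝ)).mulVec v =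
     2 * (-(v 0^2+v 1^2+v 2^2+v 3^2+v 4^2+v 5^2+v 6^2+v 7^2+v 8^2+v 9^2+v 10^2)
    + v 6 * (v 0 + v 1 + v 2) + v 7 * (v 0 + v 3 + v 4) + v 8 * (v 1 + v 3 + v 5)
    + v 9 * (v 2 + v 4 + v 5) + v 10 * (v 3 + v 4 + v 5)) := by
    simp [M, Matrix.mulVec, dotProduct, Fin.sum_univ_succ]
    ring_nf!
  rw [e]
  have h9 : v 9 = - v 7 - v 8 := by linarith
  rw [h9]
  nlinarith [sq_nonneg (2 * v 0 - v 6 - v 7), sq_nonneg (2 * v 1 - v 6 - v 8),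
    sq_nonneg (2 * v 2 - v 6 - (-v 7 - v 8)), sq_nonneg (2 * v 3 - v 7 - v 8 - v 10),
    sq_nonneg (2 * v 4 - v 7 - (-v 7 - v 8) - v 10),
    sq_nonneg (2 * v 5 - v 8 - (-v 7 - v 8) - v 10),
    sq_nonneg (v 10), sq_nonneg (v 6), sq_nonneg (v 7), sq_nonneg (v 8),
    sq_nonneg (v 7 + v 8)]

theorem eig_form (hH : (M.map (Int.cast : ℤ → ℝ)).IsHermitian) (i j : Fin 11) (hij : i ≠ j)
    (a b : ℝ) (w : Fin 11 → ℝ)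
    (hw : w = a • (hH.eigenvectorBasis i).ofLp + b • (hH.eigenvectorBasis j).ofLp) :
    w ⬝ᵥ (M.map (Int.cast : ℤ → ℝ)).mulVec w
      = a^2 * hH.eigenvalues i + b^2 * hH.eigenvalues j := by
  have key : ∀ k l, (hH.eigenvectorBasis k).ofLp ⬝ᵥ (hH.eigenvectorBasis l).ofLp
      = if k = l then (1:ℝ) else 0 := by
    intro k l
    have := orthonormal_iff_ite.mp hH.eigenvectorBasis.orthonormal l k
    rw [EuclideanSpace.inner_eq_star_dotProduct] at this
    simpa [eq_comm] using this
  subst hw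
  simp only [Matrix.mulVec_add, Matrix.mulVec_smul, hH.mulVec_eigenvectorBasis,
    dotProduct_add, add_dotProduct, smul_dotProduct, dotProduct_smul, key, hij, hij.symm,
    if_true, if_false, smul_eq_mul]
  ring

theorem eig_unique (hH : (M.map (Int.cast : ℤ → ℝ)).IsHermitian) (i j : Fin 11)
    (hi : 0 < hH.eigenvalues i) (hj : 0 < hH.eigenvalues j) : i = j := by
  by_contra hij
  set u := (hH.eigenvectorBasis i).ofLp with hu
  set w := (hH.eigenvectorBasis j).ofLp with hw
  have main : ∀ a b : ℝ, a * (u 7 + u 8 + u 9) + b * (w 7 + w 8 + w 9) = 0 → a = 0 := by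
    intro a b hab
    have h1 := eig_form hH i j hij a b _ rfl
    have h2 := M_form_le (a • u + b • w) (by
      simp only [Pi.add_apply, Pi.smul_apply, smul_eq_mul]; linarith)
    rw [h1] at h2
    by_contra ha
    have : 0 < a^2 * hH.eigenvalues i := by positivity
    have : 0 ≤ b^2 * hH.eigenvalues j := by positivity
    linarith
  have h1 := main (w 7 + w 8 + w 9) (-(u 7 + u 8 + u 9)) (by ring)
  by_cases hz : u 7 + u 8 + u 9 = 0
  · exact one_ne_zero (main 1 0 (by rw [hz]; ring))
  · -- swap the roles: here `w` lies in the hyperplane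
    have e1 := eig_form hH i j hij 0 1 _ rfl
    have e2 := M_form_le ((0:ℝ) • u + (1:ℝ) • w) (by
      simp only [Pi.add_apply, Pi.smul_apply, smul_eq_mul]; linarith)
    rw [e1] at e2
    linarith

theorem M_det_real : (M.map (Int.cast : ℤ → ℝ)).det = 128 := by
  have h := (Int.castRingHom ℝ).map_det M
  rw [M_det_eq] at h
  simpa [RingHom.mapMatrix_apply] using h.symm

theorem M_det_rat : (M.map (Int.cast : ℤ → ℚ)).det = 128 := by
  have h := (Int.castRingHom ℚ).map_det M
  rw [M_det_eq] at h
  simpa [RingHom.mapMatrix_apply] using h.symm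

theorem M_signature (hH : (M.map (Int.cast : ℤ → ℝ)).IsHermitian) :
    Nat.card {i : Fin 11 // 0 < hH.eigenvalues i} = 1 ∧
      Nat.card {i : Fin 11 // hH.eigenvalues i < 0} = 10 := by
  have hd : ∏ i, hH.eigenvalues i = 128 := by
    have := hH.det_eq_prod_eigenvalues
    rw [M_det_real] at this
    simpa using this.symm
  have hne : ∀ i, hH.eigenvalues i ≠ 0 := by
    intro i hi
    rw [Finset.prod_eq_zero (Finset.mem_univ i) hi] at hd
    norm_num at hd
  have hex : ∃ i, 0 < hH.eigenvalues i := by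
    by_contra! hc
    have h0 : 0 ≤ ∏ i, (-hH.eigenvalues i) :=
      Finset.prod_nonneg fun i _ => by linarith [hc i]
    rw [Finset.prod_neg, hd] at h0
    norm_num at h0
  obtain ⟨k, hk⟩ := hex
  have hpos : ∀ i, 0 < hH.eigenvalues i ↔ i = k :=
    fun i => ⟨fun h => eig_unique hH i k h hk, fun h => h ▸ hk⟩
  have hneg : ∀ i, hH.eigenvalues i < 0 ↔ i ≠ k := fun i => by
    rw [Ne, ← hpos i, not_lt]
    exact ⟨le_of_lt, fun h => lt_of_le_of_ne h (hne i)⟩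
  constructor
  · simp [hpos]
  · simp [hneg, Fintype.card_subtype_compl]

/-- `M` is an even lattice Gram matrix of rank 11, signature `(1,10)` and
discriminant `2⁷ = 128`: every `vᵀMv` is even, `det M = 128` (so `M` is invertible
over `ℚ`), and the real symmetric matrix `M` has exactly one positive and ten
negative eigenvalues. -/
theorem M_even_signature_discriminant :
    (∀ v : Fin 11 → ℤ, Even (v ⬝ᵥ M.mulVec v)) ∧
    M.det = 128 ∧
    IsUnit ((M.map (Int.cast : ℤ → ℚ)).det) ∧
    ∀ hH : (M.map (Int.cast : ℤ → ℝ)).IsHermitian,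
      Nat.card {i : Fin 11 // 0 < hH.eigenvalues i} = 1 ∧
      Nat.card {i : Fin 11 // hH.eigenvalues i < 0} = 10 := by
  refine ⟨M_even, M_det_eq, ?_, M_signature⟩
  rw [M_det_rat]
  exact isUnit_iff_ne_zero.mpr (by norm_num)
end

section
/- The cokernel of the linear map ℤ^11 → ℤ^11 given by the matrix M, i.e. the quotient abelian group ℤ^11 / M·ℤ^11, is isomorphic to (ℤ/8ℤ) × (ℤ/4ℤ) × (ℤ/4ℤ). Moreover it is generated by the cosets of the three standard basis vectors at the positions indexed by e1, l23 and l24, which have orders 8, 4 and 4 respectively. -/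
open Matrix

/-- The sublattice `M·ℤ¹¹ ⊆ ℤ¹¹`, i.e. the image of the linear map given by `M`. -/
def MLat : Submodule ℤ (Fin 11 → ℤ) := LinearMap.range M.mulVecLin

/-- The three integral functionals describing the discriminant group. -/
def phi1 (v : Fin 11 → ℤ) : ℤ := 6 * v 0 + 2 * v 1 + 2 * v 2 + 4 * v 5 + 1 * v 6 + 3 * v 7 + 3 * v 8 + 3 * v 9 + 2 * v 10
def phi2 (v : Fin 11 → ℤ) : ℤ := 3 * v 0 + 1 * v 2 + 1 * v 3 + 3 * v 5 + 2 * v 7 + 2 * v 9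
def phi3 (v : Fin 11 → ℤ) : ℤ := 3 * v 0 + 1 * v 1 + 1 * v 4 + 3 * v 5 + 2 * v 7 + 2 * v 8

lemma mem_MLat_iff (v : Fin 11 → ℤ) :
    v ∈ MLat ↔ (8 ∣ phi1 v ∧ 4 ∣ phi2 v ∧ 4 ∣ phi3 v) := by
  constructor
  · rintro ⟨w, rfl⟩
    simp only [phi1, phi2, phi3, Matrix.mulVecLin_apply, Matrix.mulVec, dotProduct, M,
      Fin.sum_univ_succ, Matrix.of_apply]
    simp
    refine ⟨?_, ?_, ?_⟩ <;> ring_nf <;> omega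
  · rintro ⟨⟨a, ha⟩, ⟨b, hb⟩, ⟨c, hc⟩⟩
    simp only [phi1, phi2, phi3] at ha hb hc
    refine ⟨![(2) * v 0 + (1) * v 1 + (1) * v 2 + (2) * v 5 + (1) * v 7 + (2) * v 8 + (2) * v 9 + (2) * v 10 + (-6) * a + (1) * b + (1) * c,
      (2) * v 0 + (1) * v 2 + (1) * v 5 + (1) * v 7 + (1) * v 8 + (2) * v 9 + (2) * v 10 + (-6) * a + (1) * b + (2) * c,
      (2) * v 0 + (1) * v 1 + (1) * v 5 + (1) * v 7 + (2) * v 8 + (1) * v 9 + (2) * v 10 + (-6) * a + (2) * b + (1) * c,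
      (-2) * v 0 + (-1) * v 1 + (-1) * v 5 + (-1) * v 7 + (-2) * v 8 + (-1) * v 10 + (4) * a + (-2) * b + (1) * c,
      (-2) * v 0 + (-1) * v 2 + (-1) * v 5 + (-1) * v 7 + (-2) * v 9 + (-1) * v 10 + (4) * a + (1) * b + (-2) * c,
      (-4) * v 0 + (-1) * v 1 + (-1) * v 2 + (-4) * v 5 + (-2) * v 7 + (-2) * v 8 + (-2) * v 9 + (-1) * v 10 + (4) * a + (1) * b + (1) * c,
      (6) * v 0 + (2) * v 1 + (2) * v 2 + (4) * v 5 + (3) * v 7 + (4) * v 8 + (4) * v 9 + (4) * v 10 + (-13) * a + (2) * b + (2) * c,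
      (-1) * v 0 + (-1) * v 7 + (1) * a,
      (-2) * v 0 + (-1) * v 1 + (-2) * v 5 + (-1) * v 7 + (-2) * v 8 + (1) * a + (2) * c,
      (-2) * v 0 + (-1) * v 2 + (-2) * v 5 + (-1) * v 7 + (-2) * v 9 + (1) * a + (2) * b,
      (-4) * v 0 + (-1) * v 1 + (-1) * v 2 + (-3) * v 5 + (-2) * v 7 + (-2) * v 8 + (-2) * v 9 + (-2) * v 10 + (6) * a], ?_⟩
    ext i
    fin_cases i <;>
      simp [Matrix.mulVec, dotProduct, M, Fin.sum_univ_succ] <;> linarith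

/-- The map `ℤ¹¹ → ℤ/8 × ℤ/4 × ℤ/4`. -/
def phi : (Fin 11 → ℤ) →ₗ[ℤ] (ZMod 8 × ZMod 4 × ZMod 4) where
  toFun v := ((phi1 v : ZMod 8), (phi2 v : ZMod 4), (phi3 v : ZMod 4))
  map_add' v w := by
    simp only [phi1, phi2, phi3, Pi.add_apply, Prod.mk_add_mk, Prod.mk.injEq]
    push_cast
    refine ⟨?_, ?_, ?_⟩ <;> ring
  map_smul' m v := by
    simp only [phi1, phi2, phi3, Pi.smul_apply, smul_eq_mul, Prod.smul_mk, zsmul_eq_mul,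
      Prod.mk.injEq, RingHom.id_apply]
    push_cast
    refine ⟨?_, ?_, ?_⟩ <;> ring

lemma ker_phi : LinearMap.ker phi = MLat := by
  ext v
  rw [mem_MLat_iff, LinearMap.mem_ker]
  change (((phi1 v : ZMod 8), (phi2 v : ZMod 4), (phi3 v : ZMod 4)) :
    ZMod 8 × ZMod 4 × ZMod 4) = 0 ↔ _
  rw [Prod.mk_eq_zero, Prod.mk_eq_zero, ZMod.intCast_zmod_eq_zero_iff_dvd,
    ZMod.intCast_zmod_eq_zero_iff_dvd, ZMod.intCast_zmod_eq_zero_iff_dvd]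
  rfl

lemma phi_six : phi (Pi.single 6 1) = (1, 0, 0) := by decide
lemma phi_three : phi (Pi.single 3 1) = (0, 1, 0) := by decide
lemma phi_four : phi (Pi.single 4 1) = (0, 0, 1) := by decide

lemma phi_comb (x : ZMod 8 × ZMod 4 × ZMod 4) :
    ∃ a b c : ℤ, x = a • phi (Pi.single 6 1) + b • phi (Pi.single 3 1)
      + c • phi (Pi.single 4 1) := by
  obtain ⟨x, y, z⟩ := x
  obtain ⟨a, rfl⟩ := ZMod.intCast_surjective x
  obtain ⟨b, rfl⟩ := ZMod.intCast_surjective y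
  obtain ⟨c, rfl⟩ := ZMod.intCast_surjective z
  refine ⟨a, b, c, ?_⟩
  rw [phi_six, phi_three, phi_four]
  simp

lemma phi_surj : Function.Surjective phi := by
  intro x
  obtain ⟨a, b, c, rfl⟩ := phi_comb x
  exact ⟨a • Pi.single 6 1 + b • Pi.single 3 1 + c • Pi.single 4 1, by simp only [map_add, map_smul]⟩

/-- The isomorphism of the discriminant group with `ℤ/8 × ℤ/4 × ℤ/4`. -/
noncomputable def discEquiv :
    ((Fin 11 → ℤ) ⧸ MLat) ≃ₗ[ℤ] (ZMod 8 × ZMod 4 × ZMod 4) :=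
  (Submodule.quotEquivOfEq _ _ ker_phi.symm).trans (phi.quotKerEquivOfSurjective phi_surj)

lemma discEquiv_mk (v : Fin 11 → ℤ) :
    discEquiv (Submodule.Quotient.mk (p := MLat) v) = phi v := rfl

/-- **Lemma 3.4 (first part).** The discriminant group `A_M = ℤ¹¹ / M·ℤ¹¹` of the
lattice with Gram matrix `M` is isomorphic to `(ℤ/8ℤ) × (ℤ/4ℤ) × (ℤ/4ℤ)`, and it is
generated by the cosets of the standard basis vectors at the positions indexed by
`e1` (index 6), `l23` (index 3) and `l24` (index 4), of orders `8`, `4` and `4`. -/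
theorem discriminant_group_of_M :
    Nonempty (((Fin 11 → ℤ) ⧸ MLat) ≃ₗ[ℤ] (ZMod 8 × ZMod 4 × ZMod 4)) ∧
    Submodule.span ℤ
      ({Submodule.Quotient.mk (p := MLat) (Pi.single 6 1),
        Submodule.Quotient.mk (p := MLat) (Pi.single 3 1),
        Submodule.Quotient.mk (p := MLat) (Pi.single 4 1)} :
        Set ((Fin 11 → ℤ) ⧸ MLat)) = ⊤ ∧
    addOrderOf (Submodule.Quotient.mk (p := MLat) (Pi.single 6 1)) = 8 ∧
    addOrderOf (Submodule.Quotient.mk (p := MLat) (Pi.single 3 1)) = 4 ∧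
    addOrderOf (Submodule.Quotient.mk (p := MLat) (Pi.single 4 1)) = 4 := by
  refine ⟨⟨discEquiv⟩, ?_, ?_, ?_, ?_⟩
  · rw [eq_top_iff]
    rintro q -
    obtain ⟨a, b, c, h⟩ := phi_comb (discEquiv q)
    rw [← discEquiv_mk, ← discEquiv_mk, ← discEquiv_mk, ← map_smul, ← map_smul, ← map_smul,
      ← map_add, ← map_add] at h
    rw [discEquiv.injective h]
    refine add_mem (add_mem ?_ ?_) ?_ <;>
      exact Submodule.smul_mem _ _ (Submodule.subset_span (by simp))
  · rw [← addOrderOf_injective discEquiv.toLinearMap.toAddMonoidHom discEquiv.injective]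
    change addOrderOf (phi (Pi.single 6 1)) = 8
    rw [phi_six, addOrderOf_eq_iff (by norm_num)]
    decide
  · rw [← addOrderOf_injective discEquiv.toLinearMap.toAddMonoidHom discEquiv.injective]
    change addOrderOf (phi (Pi.single 3 1)) = 4
    rw [phi_three, addOrderOf_eq_iff (by norm_num)]
    decide
  · rw [← addOrderOf_injective discEquiv.toLinearMap.toAddMonoidHom discEquiv.injective]
    change addOrderOf (phi (Pi.single 4 1)) = 4
    rw [phi_four, addOrderOf_eq_iff (by norm_num)]
    decide
end

section
/- The product α·β of the two matrices α and β has infinite order: for every positive integer n, (α·β)^n is not the identity matrix. -/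
open Matrix

/-- The matrix of the isometry `φ4*` of the Neron–Severi lattice induced by the covering
involution of the projection of a 4-nodal tetrahedral quartic from its node `E4`, in the
basis `(l12, l13, l14, l23, l24, l34, e1, e2, e3, e4, r1)`. -/
def α : Matrix (Fin 11) (Fin 11) ℤ := Matrix.of
  ![![-1, 0, 0, 0, 0, 0, 0, 0, 0, 0, 0],
    ![ 0,-1, 0, 0, 0, 0, 0, 0, 0, 0, 0],
    ![-1,-1, 0, 0, 0, 0, 1, 0, 0,-1, 0],
    ![ 1, 1, 0, 0, 0, 0, 0, 0, 0, 2, 1],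
    ![ 0, 1, 0, 0, 0, 0, 0, 1, 0, 1, 0],
    ![ 1, 0, 0, 0, 0, 0, 0, 0, 1, 1, 0],
    ![-1,-1, 1, 0, 0, 0, 0, 0, 0,-1, 0],
    ![ 0, 1, 0, 0, 1, 0, 0, 0, 0, 1, 0],
    ![ 1, 0, 0, 0, 0, 1, 0, 0, 0, 1, 0],
    ![ 0, 0, 0, 0, 0, 0, 0, 0, 0,-1, 0],
    ![ 1, 1, 0, 1, 0, 0, 0, 0, 0, 2, 0]]

/-- The matrix of the isometry `φ3*` of the Neron–Severi lattice induced by the covering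
involution of the projection of a 4-nodal tetrahedral quartic from its node `E3`, in the
basis `(l12, l13, l14, l23, l24, l34, e1, e2, e3, e4, r1)`. -/
def β : Matrix (Fin 11) (Fin 11) ℤ := Matrix.of
  ![![-1, 0, 0, 0, 0, 0, 0, 0, 0, 0, 0],
    ![-1, 0,-1, 0, 0, 0, 1, 0,-1, 0, 0],
    ![ 0, 0,-1, 0, 0, 0, 0, 0, 0, 0, 0],
    ![ 0, 0, 1, 0, 0, 0, 0, 1, 1, 0, 0],
    ![ 1, 0, 1, 0, 0, 0, 0, 0, 2, 0, 1],
    ![ 1, 0, 0, 0, 0, 0, 0, 0, 1, 1, 0],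
    ![-1, 1,-1, 0, 0, 0, 0, 0,-1, 0, 0],
    ![ 0, 0, 1, 1, 0, 0, 0, 0, 1, 0, 0],
    ![ 0, 0, 0, 0, 0, 0, 0, 0,-1, 0, 0],
    ![ 1, 0, 0, 0, 0, 1, 0, 0, 1, 0, 0],
    ![ 1, 0, 1, 0, 1, 0, 0, 0, 2, 0, 0]]

/-- `(α * β) ^ 2` is unipotent of index three. -/
theorem unip_cube : ((α * β) * (α * β) - 1) * (((α * β) * (α * β) - 1) * ((α * β) * (α * β) - 1)) = 0 := by
  decide +kernel

theorem unip_sq_ne : ((α * β) * (α * β) - 1) * ((α * β) * (α * β) - 1) ≠ 0 := by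
  decide +kernel

/-- Powers of `1 + N` when `N ^ 3 = 0`, multiplied by `N`. -/
theorem unip_pow {R : Type*} [Ring R] (N : R) (h : N * (N * N) = 0) (n : ℕ) :
    N * (1 + N) ^ n = N + n • (N * N) := by
  induction n with
  | zero => simp
  | succ k ih =>
    have h' : N * N * N = 0 := by rw [mul_assoc, h]
    rw [pow_succ, ← mul_assoc, ih, mul_add, mul_one, add_mul, smul_mul_assoc, h', smul_zero,
      add_zero, succ_nsmul, add_assoc]

/-- **Proposition 3.2 / Corollary 3.3.** The product `α·β` of the matrices of the
isometries `φ4*` and `φ3*` has infinite order: no positive power of it is the identity.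
(Hence the automorphism group of the minimal resolution of a 4-nodal tetrahedral
quartic is infinite.) -/
theorem alpha_mul_beta_infinite_order : ∀ n : ℕ, 0 < n → (α * β) ^ n ≠ 1 := by
  intro n hn h
  have h3 := unip_pow _ unip_cube n
  rw [add_sub_cancel, ← pow_two (α * β), ← pow_mul, mul_comm 2 n, pow_mul, h, one_pow,
    mul_one, left_eq_add, pow_two (α * β)] at h3
  apply unip_sq_ne
  ext i j
  have h4 := congrFun (congrFun h3 i) j
  rw [Matrix.smul_apply] at h4
  exact (smul_eq_zero.mp h4).resolve_left hn.ne'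
end
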